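/- Let K be a field and Q the quiver of type D₄ with vertices {1,2,3,4} and three arrows 3 → 1, 3 → 2, 3 → 4. Let M be the indecomposable representation of Q with dimension vector (1,1,2,1) (so dim M₃ = 2 and dim M₁ = dim M₂ = dim M₄ = 1), let i ∈ {1,2,4}, and let N be an indecomposable subrepresentation of M of composition length 4 containing the simple subrepresentation S(i). Then for every length function l on the category of finite-dimensional K-representations of Q, the indecomposable filtration (S(i) < N < M) is NOT a GR filtration of M with respect to l. -/

import Mathlib

open scoped Classical

namespace QR

/-- A finite quiver: finite sets of vertices and arrows with source and target maps. -/
structure FinQuiver where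
  V : Type
  A : Type
  [fintypeV : Fintype V]
  [fintypeA : Fintype A]
  s : A → V
  t : A → V

attribute [instance] FinQuiver.fintypeV FinQuiver.fintypeA

/-- One oriented step along an arrow of `Q`. -/
def FinQuiver.Step (Q : FinQuiver) (v w : Q.V) : Prop := ∃ a : Q.A, Q.s a = v ∧ Q.t a = w

/-- `Q` is acyclic: it contains no oriented cycle. -/
def FinQuiver.Acyclic (Q : FinQuiver) : Prop := ∀ v : Q.V, ¬ Relation.TransGen Q.Step v v

/-- A finite-dimensional `K`-linear representation of the quiver `Q`. -/
structure Rep (K : Type) [Field K] (Q : FinQuiver) where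
  space : Q.V → Type
  [instAddCommGroup : ∀ v, AddCommGroup (space v)]
  [instModule : ∀ v, Module K (space v)]
  [instFinite : ∀ v, FiniteDimensional K (space v)]
  map : ∀ a : Q.A, space (Q.s a) →ₗ[K] space (Q.t a)

attribute [instance] Rep.instAddCommGroup Rep.instModule Rep.instFinite

variable {K : Type} [Field K] {Q : FinQuiver}

/-- A morphism of representations: linear maps commuting with the structure maps. -/
structure Hom (N M : Rep K Q) where
  app : ∀ v, N.space v →ₗ[K] M.space v
  comm : ∀ a : Q.A, (M.map a).comp (app (Q.s a)) = (app (Q.t a)).comp (N.map a)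

/-- Composition of morphisms of representations. -/
def Hom.comp {X Y Z : Rep K Q} (g : Hom Y Z) (f : Hom X Y) : Hom X Z where
  app v := (g.app v).comp (f.app v)
  comm a := by
    ext x
    have h1 := LinearMap.congr_fun (f.comm a) x
    have h2 := LinearMap.congr_fun (g.comm a) (f.app (Q.s a) x)
    simp only [LinearMap.comp_apply] at h1 h2 ⊢
    rw [h2, h1]

/-- A representation is nonzero if some vertex space contains a nonzero vector. -/
def Rep.Nonzero (M : Rep K Q) : Prop := ∃ v, ∃ x : M.space v, x ≠ 0

/-- A representation is zero if all its vertex spaces are trivial. -/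
def IsZeroRep (M : Rep K Q) : Prop := ∀ v, ∀ x : M.space v, x = 0

/-- Two representations are isomorphic iff there is a morphism between them that is
bijective at every vertex. -/
def Iso (N M : Rep K Q) : Prop := ∃ f : Hom N M, ∀ v, Function.Bijective (f.app v)

/-- The direct sum of two representations. -/
noncomputable def dsum (N N' : Rep K Q) : Rep K Q where
  space v := N.space v × N'.space v
  map a := (N.map a).prodMap (N'.map a)

/-- A representation is indecomposable if it is nonzero and not isomorphic to the
direct sum of two nonzero representations. -/
def Indecomposable (M : Rep K Q) : Prop :=
  M.Nonzero ∧ ¬ ∃ N N' : Rep K Q, N.Nonzero ∧ N'.Nonzero ∧ Iso M (dsum N N')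

/-- A representation is thin if all its vertex spaces have dimension at most one. -/
def Rep.Thin (M : Rep K Q) : Prop := ∀ v, Module.finrank K (M.space v) ≤ 1

/-- Vertices of the support of `M`. -/
def suppV (M : Rep K Q) : Set Q.V := {v | ∃ x : M.space v, x ≠ 0}

/-- Arrows of the support of `M`. -/
def suppA (M : Rep K Q) : Set Q.A := {a | M.map a ≠ 0}

/-- Two vertices are adjacent in the underlying graph of the subquiver with arrow set
`SA` if some arrow of `SA` joins them (in either direction). -/
def AdjIn (Q : FinQuiver) (SA : Set Q.A) (v w : Q.V) : Prop :=
  ∃ a ∈ SA, (Q.s a = v ∧ Q.t a = w) ∨ (Q.s a = w ∧ Q.t a = v)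

/-- The subquiver with vertex set `SV` and arrow set `SA` is connected: any two of its
vertices are joined by a walk using its arrows. -/
def ConnectedOn (Q : FinQuiver) (SV : Set Q.V) (SA : Set Q.A) : Prop :=
  ∀ v ∈ SV, ∀ w ∈ SV, Relation.ReflTransGen (AdjIn Q SA) v w

/-- The underlying graph of the subquiver with arrow set `SA` contains a cycle:
there are pairwise distinct arrows `e 0, …, e n` in `SA` and pairwise distinct
vertices `v 0, …, v n` such that `e i` joins `v i` and `v (i+1)` (cyclically,
in either direction). -/
def HasCycle (Q : FinQuiver) (SA : Set Q.A) : Prop :=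
  ∃ (n : ℕ) (e : Fin (n + 1) → Q.A) (v : Fin (n + 1) → Q.V),
    Function.Injective e ∧ (∀ i, e i ∈ SA) ∧ Function.Injective v ∧
    ∀ i : Fin (n + 1), (Q.s (e i) = v i ∧ Q.t (e i) = v (i + 1)) ∨
      (Q.s (e i) = v (i + 1) ∧ Q.t (e i) = v i)

/-- The underlying graph of the subquiver `(SV, SA)` is a tree:
nonempty, connected and with no cycles. -/
def IsTreeOn (Q : FinQuiver) (SV : Set Q.V) (SA : Set Q.A) : Prop :=
  SV.Nonempty ∧ ConnectedOn Q SV SA ∧ ¬ HasCycle Q SA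

/-- The underlying graph of the subquiver `(SV, SA)` is a cycle on `n + 1 ≥ 2` vertices. -/
def IsCycleOn (Q : FinQuiver) (SV : Set Q.V) (SA : Set Q.A) : Prop :=
  ∃ n : ℕ, 0 < n ∧ ∃ (ev : Fin (n + 1) → Q.V) (ea : Fin (n + 1) → Q.A),
    Function.Injective ev ∧ Function.Injective ea ∧
    SV = Set.range ev ∧ SA = Set.range ea ∧
    ∀ i : Fin (n + 1), (Q.s (ea i) = ev i ∧ Q.t (ea i) = ev (i + 1)) ∨
      (Q.s (ea i) = ev (i + 1) ∧ Q.t (ea i) = ev i)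

/-- The canonical representation of the subquiver `(SV, SA)`: the field `K` at the
vertices of `SV`, zero elsewhere, identity maps on the arrows of `SA` (realised as
submodules of `K` and inclusions), zero maps elsewhere. -/
noncomputable def canonical (K : Type) [Field K] (Q : FinQuiver)
    (SV : Set Q.V) (SA : Set Q.A) : Rep K Q where
  space v := ↥(if v ∈ SV then (⊤ : Submodule K K) else ⊥)
  map a :=
    if a ∈ SA then
      (if h : (if Q.s a ∈ SV then (⊤ : Submodule K K) else ⊥) ≤
          (if Q.t a ∈ SV then (⊤ : Submodule K K) else ⊥)
        then Submodule.inclusion h else 0)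
    else 0

/-- The simple representation `S(i)`. -/
noncomputable def simple (K : Type) [Field K] (Q : FinQuiver) (i : Q.V) : Rep K Q :=
  canonical K Q {i} ∅

/-- A family of submodules of the vertex spaces of `M` is a subrepresentation if it is
closed under the structure maps. -/
def IsSubRep (M : Rep K Q) (p : ∀ v, Submodule K (M.space v)) : Prop :=
  ∀ a : Q.A, ∀ x ∈ p (Q.s a), M.map a x ∈ p (Q.t a)

/-- The representation carried by a subrepresentation of `M`. -/
noncomputable def restrictRep (M : Rep K Q) (p : ∀ v, Submodule K (M.space v)) : Rep K Q where
  space v := ↥(p v)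
  map a :=
    if h : ∀ x ∈ p (Q.s a), M.map a x ∈ p (Q.t a) then (M.map a).restrict h else 0

/-- The quotient representation `M / p`. -/
noncomputable def quotRep (M : Rep K Q) (p : ∀ v, Submodule K (M.space v)) : Rep K Q where
  space v := M.space v ⧸ p v
  map a :=
    if h : p (Q.s a) ≤ (p (Q.t a)).comap (M.map a) then
      Submodule.mapQ (p (Q.s a)) (p (Q.t a)) (M.map a) h
    else 0

/-- A length function on the category of finite-dimensional `K`-representations of `Q`:
nonnegative real valued, zero exactly on the zero representations, and additive on
short exact sequences. -/
def LengthFunction (l : Rep K Q → ℝ) : Prop :=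
  (∀ X, 0 ≤ l X) ∧ (∀ X, l X = 0 ↔ IsZeroRep X) ∧
    ∀ (X Y Z : Rep K Q) (f : Hom X Y) (g : Hom Y Z),
      (∀ v, Function.Injective (f.app v)) →
      (∀ v, Function.Surjective (g.app v)) →
      (∀ v, LinearMap.range (f.app v) = LinearMap.ker (g.app v)) →
      l Y = l X + l Z


/-- The lexicographic order on finite chains (= finite subsets) of `ℝ`:
`X ≤ₗ Y` iff `min (Y \ X) ≤ min (X \ Y)`, with the convention `min ∅ = ∞`. -/
def RLexLE (X Y : Finset ℝ) : Prop := (Y \ X).min ≤ (X \ Y).min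

/-- `p` is an indecomposable subrepresentation of `M`. -/
def IndecSub (M : Rep K Q) (p : ∀ v, Submodule K (M.space v)) : Prop :=
  IsSubRep M p ∧ Indecomposable (restrictRep M p)

/-- `C` is a finite chain of indecomposable subrepresentations of `M`. -/
def IndecChain (M : Rep K Q) (C : Finset (∀ v, Submodule K (M.space v))) : Prop :=
  (∀ p ∈ C, IndecSub M p) ∧ ∀ p ∈ C, ∀ q ∈ C, p ≤ q ∨ q ≤ p

/-- The values of the length function `l` on the members of a chain of
subrepresentations of `M`. -/
noncomputable def chainL (l : Rep K Q → ℝ) (M : Rep K Q)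
    (C : Finset (∀ v, Submodule K (M.space v))) : Finset ℝ :=
  C.image fun p => l (restrictRep M p)

/-- An indecomposable filtration of `M`: a chain of indecomposable subrepresentations,
starting at a minimal (i.e. simple) one, each a direct predecessor of the next in the
poset of indecomposable subrepresentations, and ending at `M` itself. -/
def IndecFiltration (M : Rep K Q) {m : ℕ}
    (𝒩 : Fin (m + 1) → ∀ v, Submodule K (M.space v)) : Prop :=
  (∀ i, IndecSub M (𝒩 i)) ∧
  (∀ r, IndecSub M r → r ≤ 𝒩 0 → r = 𝒩 0) ∧
  (∀ i : Fin m, 𝒩 i.castSucc ≤ 𝒩 i.succ ∧ 𝒩 i.castSucc ≠ 𝒩 i.succ ∧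
    ∀ r, IndecSub M r → 𝒩 i.castSucc ≤ r → r ≤ 𝒩 i.succ →
      r = 𝒩 i.castSucc ∨ r = 𝒩 i.succ) ∧
  𝒩 (Fin.last m) = fun _ => ⊤

/-- `Z` is the Gabriel-Roiter measure `μ_l(M)`: the lexicographically greatest element of
the set of `l`-values of finite chains of indecomposable subrepresentations of `M`
with maximum `M`. -/
def IsGRMeasure (l : Rep K Q → ℝ) (M : Rep K Q) (Z : Finset ℝ) : Prop :=
  (∃ C, IndecChain M C ∧ (fun _ => (⊤ : Submodule K _)) ∈ C ∧ chainL l M C = Z) ∧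
  ∀ C, IndecChain M C → (fun _ => (⊤ : Submodule K _)) ∈ C → RLexLE (chainL l M C) Z

/-- `𝒩` is a GR filtration of `M` with respect to `l`: an indecomposable filtration
whose chain of `l`-values attains the Gabriel-Roiter measure of `M`. -/
def IsGRFiltration (l : Rep K Q → ℝ) (M : Rep K Q) {m : ℕ}
    (𝒩 : Fin (m + 1) → ∀ v, Submodule K (M.space v)) : Prop :=
  IndecFiltration M 𝒩 ∧
    ∀ C, IndecChain M C → (fun _ => (⊤ : Submodule K _)) ∈ C →
      RLexLE (chainL l M C) (chainL l M (Finset.image 𝒩 Finset.univ))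

/-- `(SV, SA)` is a subquiver of `Q`: arrows of `SA` have their endpoints in `SV`. -/
def IsSubquiver (Q : FinQuiver) (P : Set Q.V × Set Q.A) : Prop :=
  ∀ a ∈ P.2, Q.s a ∈ P.1 ∧ Q.t a ∈ P.1

/-- `P` is a member of `ℒ(Q)`, the poset of connected nonempty subquivers of `Q`. -/
def InL (Q : FinQuiver) (P : Set Q.V × Set Q.A) : Prop :=
  IsSubquiver Q P ∧ P.1.Nonempty ∧ ConnectedOn Q P.1 P.2

/-- The order `≤_C` on subquivers: `P` is a subquiver of `P'` and every arrow of `P'`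
whose source lies in `P` also has its target in `P`. -/
def leC (Q : FinQuiver) (P P' : Set Q.V × Set Q.A) : Prop :=
  P.1 ⊆ P'.1 ∧ P.2 ⊆ P'.2 ∧ ∀ a ∈ P'.2, Q.s a ∈ P.1 → Q.t a ∈ P.1

/-- The total weight of the vertices of a subquiver. -/
noncomputable def qweight (w : Q.V → ℝ) (P : Set Q.V × Set Q.A) : ℝ :=
  ∑ v : Q.V, if v ∈ P.1 then w v else 0

/-- `C` is a finite chain in the poset `ℒ(Q)`. -/
def LChain (Q : FinQuiver) (C : Finset (Set Q.V × Set Q.A)) : Prop :=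
  (∀ P ∈ C, InL Q P) ∧ ∀ P ∈ C, ∀ P' ∈ C, leC Q P P' ∨ leC Q P' P

/-- The weights of the members of a chain of subquivers. -/
noncomputable def qchainW (w : Q.V → ℝ) (C : Finset (Set Q.V × Set Q.A)) : Finset ℝ :=
  C.image (qweight w)

/-- A filtration in the poset `ℒ(Q)`: starting at a minimal connected subquiver, each
member a direct predecessor of the next one. -/
def LFiltration (Q : FinQuiver) {m : ℕ} (𝒬 : Fin (m + 1) → Set Q.V × Set Q.A) : Prop :=
  (∀ i, InL Q (𝒬 i)) ∧
  (∀ P, InL Q P → leC Q P (𝒬 0) → P = 𝒬 0) ∧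
  ∀ i : Fin m, leC Q (𝒬 i.castSucc) (𝒬 i.succ) ∧ 𝒬 i.castSucc ≠ 𝒬 i.succ ∧
    ∀ P, InL Q P → leC Q (𝒬 i.castSucc) P → leC Q P (𝒬 i.succ) →
      P = 𝒬 i.castSucc ∨ P = 𝒬 i.succ

/-- `Z` is the value `w*(P₀)` of the induced chain length function of the weight
function `w` in the poset `ℒ(Q)`. -/
def IsWStar (Q : FinQuiver) (w : Q.V → ℝ) (P₀ : Set Q.V × Set Q.A) (Z : Finset ℝ) : Prop :=
  (∃ C, LChain Q C ∧ (P₀ ∈ C ∧ ∀ P ∈ C, leC Q P P₀) ∧ qchainW w C = Z) ∧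
  ∀ C, LChain Q C → (P₀ ∈ C ∧ ∀ P ∈ C, leC Q P P₀) → RLexLE (qchainW w C) Z

/-- `𝒬` is a `w*`-filtration of `P₀` in the poset `ℒ(Q)`. -/
def IsWStarLFiltration (Q : FinQuiver) (w : Q.V → ℝ) {m : ℕ}
    (𝒬 : Fin (m + 1) → Set Q.V × Set Q.A) (P₀ : Set Q.V × Set Q.A) : Prop :=
  LFiltration Q 𝒬 ∧ 𝒬 (Fin.last m) = P₀ ∧
    ∀ C, LChain Q C → (P₀ ∈ C ∧ ∀ P ∈ C, leC Q P P₀) →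
      RLexLE (qchainW w C) (qchainW w (Finset.image 𝒬 Finset.univ))

/-- `E` is an injective object in the category of finite-dimensional
`K`-representations of `Q`. -/
def InjectiveRep (E : Rep K Q) : Prop :=
  ∀ (X Y : Rep K Q) (f : Hom X Y), (∀ v, Function.Injective (f.app v)) →
    ∀ g : Hom X E, ∃ h : Hom Y E, Hom.comp h f = g

end QR

/-- The quiver of type `D₄` with central vertex `2` (standing for the vertex "3" of the
paper) and three arrows `2 → 0`, `2 → 1`, `2 → 3` (standing for `3 → 1`, `3 → 2`,
`3 → 4`). -/
abbrev D4 : QR.FinQuiver where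
  V := Fin 4
  A := Fin 3
  s := fun _ => 2
  t := ![0, 1, 3]


namespace QR

variable {K : Type} [Field K] {Q : FinQuiver}

theorem restrictRep_map_coe {M : Rep K Q} {p : ∀ v, Submodule K (M.space v)}
    (hp : IsSubRep M p) (a : Q.A) (x : p (Q.s a)) :
    (show p (Q.t a) from (restrictRep M p).map a x).1 = M.map a x := by
  simp only [restrictRep]
  rw [dif_pos (hp a)]
  rfl

/-- A representation with two complementary nonzero subrepresentations is decomposable. -/
theorem not_indecomposable_of_isCompl {M : Rep K Q} {p q : ∀ v, Submodule K (M.space v)}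
    (hp : IsSubRep M p) (hq : IsSubRep M q) (hpq : ∀ v, IsCompl (p v) (q v))
    (hp0 : ∃ v, p v ≠ ⊥) (hq0 : ∃ v, q v ≠ ⊥) : ¬ Indecomposable M := by
  rintro ⟨-, h⟩
  refine h ⟨restrictRep M p, restrictRep M q, ?_, ?_, ?_⟩
  · obtain ⟨v, hv⟩ := hp0
    obtain ⟨x, hx, hx0⟩ := (Submodule.ne_bot_iff _).1 hv
    exact ⟨v, (⟨x, hx⟩ : p v), fun h0 => hx0 (congrArg (fun y : p v => (y : M.space v)) h0)⟩
  · obtain ⟨v, hv⟩ := hq0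
    obtain ⟨x, hx, hx0⟩ := (Submodule.ne_bot_iff _).1 hv
    exact ⟨v, (⟨x, hx⟩ : q v), fun h0 => hx0 (congrArg (fun y : q v => (y : M.space v)) h0)⟩
  · let e v : (p v × q v) ≃ₗ[K] M.space v := Submodule.prodEquivOfIsCompl (p v) (q v) (hpq v)
    refine ⟨⟨fun v => (e v).symm.toLinearMap, fun a => ?_⟩, fun v => (e v).symm.bijective⟩
    ext1 x
    obtain ⟨⟨y, z⟩, rfl⟩ := (e (Q.s a)).surjective x
    apply (e (Q.t a)).injective
    have h1 := restrictRep_map_coe hp a y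
    have h2 := restrictRep_map_coe hq a z
    have h3 : e (Q.t a) ((restrictRep M p).map a y, (restrictRep M q).map a z)
        = M.map a (e (Q.s a) (y, z)) := by
      simp only [e, Submodule.coe_prodEquivOfIsCompl', map_add]
      rw [h1, h2]
    change e (Q.t a) (((restrictRep M p).map a).prodMap ((restrictRep M q).map a)
        ((e (Q.s a)).symm (e (Q.s a) (y, z)))) =
      e (Q.t a) ((e (Q.t a)).symm (M.map a (e (Q.s a) (y, z))))
    rw [LinearEquiv.symm_apply_apply, LinearEquiv.apply_symm_apply]
    exact h3

/-- The vertex spaces of `X` with all structure maps replaced by zero. -/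
noncomputable def zeroMaps (X : Rep K Q) : Rep K Q where
  space := X.space
  map _ := 0

theorem LengthFunction.zeroMaps_lt {l : Rep K Q → ℝ} (hl : LengthFunction l) {X Y : Rep K Q}
    (hle : ∀ v, Module.finrank K (X.space v) ≤ Module.finrank K (Y.space v))
    (hlt : ∃ v, Module.finrank K (X.space v) < Module.finrank K (Y.space v)) :
    l (zeroMaps X) < l (zeroMaps Y) := by
  have hex : ∀ v, ∃ f : X.space v →ₗ[K] Y.space v, Function.Injective f := fun v =>
    (finrank_le_iff_exists_linearMap).1 (hle v)
  choose f hf using hex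
  let Z : Rep K Q :=
    { space := fun v => Y.space v ⧸ LinearMap.range (f v)
      map := fun _ => 0 }
  have hadd := hl.2.2 (zeroMaps X) (zeroMaps Y) Z
    ⟨f, fun a => (LinearMap.zero_comp (f _)).trans (LinearMap.comp_zero (f _)).symm⟩
    ⟨fun v => (LinearMap.range (f v)).mkQ, fun a =>
      (LinearMap.zero_comp (LinearMap.range (f (Q.s a))).mkQ).trans
        (LinearMap.comp_zero (LinearMap.range (f (Q.t a))).mkQ).symm⟩
    hf (fun v => Submodule.mkQ_surjective _) (fun v => (Submodule.ker_mkQ _).symm)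
  have hZ : l Z ≠ 0 := by
    intro h0
    obtain ⟨v, hv⟩ := hlt
    have hz := (hl.2.1 Z).1 h0 v
    have htop : LinearMap.range (f v) = ⊤ :=
      Submodule.Quotient.subsingleton_iff.1 ⟨fun x y => (hz x).trans (hz y).symm⟩
    have := LinearMap.finrank_range_of_inj (hf v)
    rw [htop, finrank_top] at this
    omega
  have := lt_of_le_of_ne (hl.1 Z) hZ.symm
  linarith

theorem D4_t_ne_two (a : Fin 3) : D4.t a ≠ (2 : Fin 4) := by
  revert a; decide

theorem D4_t_injective : Function.Injective D4.t := by
  intro a b; revert a b; decide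

theorem D4_vertex_cases (v : Fin 4) : v = 2 ∨ ∃ a : Fin 3, v = D4.t a := by
  revert v; decide

/-- The value of a length function on a representation of `D4` depends only on the vertex
spaces. -/
theorem LengthFunction.eq_zeroMaps {l : Rep K D4 → ℝ} (hl : LengthFunction l) (X : Rep K D4) :
    l X = l (zeroMaps X) := by
  let o : ∀ v : Fin 4, Submodule K (X.space v) := fun v => if v = 2 then ⊥ else ⊤
  have ho2 : o 2 = ⊥ := if_pos rfl
  have hot : ∀ a : Fin 3, o (D4.t a) = ⊤ := fun a => if_neg (D4_t_ne_two a)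
  let O : Rep K D4 := { space := fun v => o v, map := fun _ => 0 }
  let C : Rep K D4 := { space := fun v => X.space v ⧸ o v, map := fun _ => 0 }
  have key : ∀ m : ∀ a : D4.A, X.space (D4.s a) →ₗ[K] X.space (D4.t a),
      l { space := X.space, map := m } = l O + l C := by
    intro m
    refine hl.2.2 O _ C ⟨fun v => (o v).subtype, fun a => ?_⟩ ⟨fun v => (o v).mkQ, fun a => ?_⟩
      (fun v => (o v).subtype_injective) (fun v => Submodule.mkQ_surjective _) (fun v => ?_)
    · ext1 x
      have hx : ((x : o 2) : X.space 2) = 0 := by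
        have := x.2
        exact (Submodule.mem_bot K).1 (ho2 ▸ this)
      change m a ((x : o 2) : X.space 2) = 0
      rw [hx]
      exact map_zero (m a)
    · ext1 x
      change (0 : X.space (D4.t a) ⧸ o (D4.t a)) = (o (D4.t a)).mkQ (m a x)
      symm
      rw [Submodule.mkQ_apply, Submodule.Quotient.mk_eq_zero, hot]
      trivial
    · rw [Submodule.range_subtype, Submodule.ker_mkQ]
  exact (key X.map).trans (key fun _ => 0).symm

theorem LengthFunction.lt_of_finrank {l : Rep K D4 → ℝ} (hl : LengthFunction l) {X Y : Rep K D4}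
    (hle : ∀ v, Module.finrank K (X.space v) ≤ Module.finrank K (Y.space v))
    (hlt : ∃ v, Module.finrank K (X.space v) < Module.finrank K (Y.space v)) : l X < l Y := by
  rw [hl.eq_zeroMaps X, hl.eq_zeroMaps Y]
  exact hl.zeroMaps_lt hle hlt

/-- A nonzero representation of `D4` generated by one vector at the central vertex, with
central space spanned by that vector, is indecomposable. -/
theorem indecomposable_of_generator (X : Rep K D4) (x : X.space 2) (hx : x ≠ 0)
    (hgen : ∀ y : X.space 2, ∃ c : K, y = c • x)
    (hgen' : ∀ (a : Fin 3) (y : X.space (D4.t a)), ∃ c : K, y = c • X.map a x) :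
    Indecomposable X := by
  refine ⟨⟨2, x, hx⟩, ?_⟩
  rintro ⟨N, N', ⟨v, n, hn⟩, ⟨w, n', hn'⟩, f, hf⟩
  have hcomm (a : Fin 3) : f.app (D4.t a) (X.map a x) =
      (N.map a (f.app 2 x).1, N'.map a (f.app 2 x).2) :=
    (LinearMap.congr_fun (f.comm a) x).symm
  have hfst : (f.app 2 x).1 ≠ 0 := by
    intro h0
    obtain ⟨y, hy⟩ := (hf v).2 (n, 0)
    apply hn
    rcases D4_vertex_cases v with rfl | ⟨a, rfl⟩
    · obtain ⟨c, rfl⟩ := hgen y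
      have := congrArg Prod.fst hy
      rw [map_smul] at this
      change c • (f.app 2 x).1 = n at this
      rw [← this, h0, smul_zero]
    · obtain ⟨c, rfl⟩ := hgen' a y
      rw [map_smul, hcomm] at hy
      have := congrArg Prod.fst hy
      change c • N.map a (f.app 2 x).1 = n at this
      rw [← this, h0]
      exact (congrArg (c • ·) (map_zero (N.map a))).trans (smul_zero c)
  have hsnd : (f.app 2 x).2 ≠ 0 := by
    intro h0
    obtain ⟨y, hy⟩ := (hf w).2 (0, n')
    apply hn'
    rcases D4_vertex_cases w with rfl | ⟨a, rfl⟩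
    · obtain ⟨c, rfl⟩ := hgen y
      have := congrArg Prod.snd hy
      rw [map_smul] at this
      change c • (f.app 2 x).2 = n' at this
      rw [← this, h0, smul_zero]
    · obtain ⟨c, rfl⟩ := hgen' a y
      rw [map_smul, hcomm] at hy
      have := congrArg Prod.snd hy
      change c • N'.map a (f.app 2 x).2 = n' at this
      rw [← this, h0]
      exact (congrArg (c • ·) (map_zero (N'.map a))).trans (smul_zero c)
  obtain ⟨y, hy⟩ := (hf 2).2 ((f.app 2 x).1, 0)
  obtain ⟨c, rfl⟩ := hgen y
  rw [map_smul] at hy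
  have h1 : c • (f.app 2 x).1 = (f.app 2 x).1 := congrArg Prod.fst hy
  have h2 : c • (f.app 2 x).2 = 0 := congrArg Prod.snd hy
  rcases smul_eq_zero.1 h2 with hc | h0
  · rw [hc, zero_smul] at h1
    exact hfst h1.symm
  · exact hsnd h0

theorem isCompl_span_singleton_ker {V W : Type*} [AddCommGroup V] [Module K V] [AddCommGroup W]
    [Module K W] (f : V →ₗ[K] W) (hW : Module.finrank K W = 1) {x : V} (hx : f x ≠ 0) :
    IsCompl (Submodule.span K {x}) (LinearMap.ker f) := by
  constructor
  · rw [Submodule.disjoint_def]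
    intro y hy hy'
    obtain ⟨c, rfl⟩ := Submodule.mem_span_singleton.1 hy
    rw [LinearMap.mem_ker, map_smul] at hy'
    rw [(smul_eq_zero.1 hy').resolve_right hx, zero_smul]
  · rw [codisjoint_iff, eq_top_iff]
    intro y _
    obtain ⟨c, hc⟩ := (finrank_eq_one_iff_of_nonzero' (f x) hx).1 hW (f y)
    refine Submodule.mem_sup.2 ⟨c • x, Submodule.smul_mem _ _ (Submodule.mem_span_singleton_self x),
      y - c • x, ?_, by abel⟩
    rw [LinearMap.mem_ker, map_sub, map_smul, hc, sub_self]

/-- The family of submodules `P` at the central vertex with the full space at the other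
vertices of `T` and zero elsewhere. -/
noncomputable def centralSub (M : Rep K D4) (P : Submodule K (M.space 2)) (T : Set (Fin 4))
    (v : Fin 4) : Submodule K (M.space v) :=
  Function.update (β := fun v : Fin 4 => Submodule K (M.space v))
    (fun v => if v ∈ T then ⊤ else ⊥) 2 P v

section centralSub

variable (M : Rep K D4) (P : Submodule K (M.space 2)) (T : Set (Fin 4))

theorem centralSub_two : centralSub M P T 2 = P := Function.update_self ..

theorem centralSub_of_mem {v : Fin 4} (h2 : v ≠ 2) (hv : v ∈ T) : centralSub M P T v = ⊤ :=
  (Function.update_of_ne h2 ..).trans (if_pos hv)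

theorem centralSub_of_notMem {v : Fin 4} (h2 : v ≠ 2) (hv : v ∉ T) : centralSub M P T v = ⊥ :=
  (Function.update_of_ne h2 ..).trans (if_neg hv)

theorem isSubRep_centralSub
    (h : ∀ a : Fin 3, D4.t a ∉ T → ∀ x ∈ P, (M.map a x : M.space (D4.t a)) = 0) :
    IsSubRep M (centralSub M P T) := by
  intro a x hx
  have hxP : x ∈ P := by
    have := centralSub_two M P T
    exact this ▸ hx
  by_cases ha : D4.t a ∈ T
  · rw [centralSub_of_mem M P T (D4_t_ne_two a) ha]
    trivial
  · rw [centralSub_of_notMem M P T (D4_t_ne_two a) ha, Submodule.mem_bot]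
    exact h a ha x hxP

end centralSub

/-- A nonzero central vector killed by two of the three arrows decomposes the
representation. -/
theorem not_indecomposable_of_map_eq_zero (M : Rep K D4)
    (hdim1 : ∀ v : Fin 4, v ≠ 2 → Module.finrank K (M.space v) = 1)
    {b c : Fin 3} (hbc : b ≠ c) {x : M.space 2} (hx : x ≠ 0)
    (hb : (M.map b x : M.space (D4.t b)) = 0) (hc : (M.map c x : M.space (D4.t c)) = 0) :
    ¬ Indecomposable M := by
  obtain ⟨d, hdb, hdc, hd⟩ : ∃ d : Fin 3, d ≠ b ∧ d ≠ c ∧ ∀ a, a = b ∨ a = c ∨ a = d := by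
    clear hb hc
    revert b c; decide
  let f : M.space 2 →ₗ[K] M.space (D4.t d) := M.map d
  obtain ⟨U, T, hU, hTd, hT0, hTU⟩ : ∃ (U : Submodule K (M.space 2)) (T : Set (Fin 4)),
      IsCompl (Submodule.span K {x}) U ∧ T ⊆ {D4.t d} ∧ (D4.t d ∉ T → f x = 0) ∧
      (D4.t d ∈ T → ∀ y ∈ U, f y = 0) := by
    by_cases h0 : f x = 0
    · obtain ⟨U, hU⟩ := exists_isCompl (Submodule.span K {x})
      exact ⟨U, ∅, hU, by simp, fun _ => h0, by simp⟩
    · exact ⟨LinearMap.ker f, {D4.t d},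
        isCompl_span_singleton_ker f (hdim1 _ (D4_t_ne_two d)) h0, subset_rfl,
        fun h => absurd rfl h, fun _ y hy => hy⟩
  refine not_indecomposable_of_isCompl (p := centralSub M (Submodule.span K {x}) T)
    (q := centralSub M U Tᶜ) (isSubRep_centralSub _ _ _ ?_) (isSubRep_centralSub _ _ _ ?_)
    ?_ ⟨2, ?_⟩ ⟨D4.t c, ?_⟩
  · intro a ha y hy
    obtain ⟨k, rfl⟩ := Submodule.mem_span_singleton.1 hy
    have : (M.map a x : M.space (D4.t a)) = 0 := by
      rcases hd a with rfl | rfl | rfl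
      exacts [hb, hc, hT0 ha]
    exact ((M.map a).map_smul k x).trans ((congrArg (k • ·) this).trans (smul_zero k))
  · intro a ha y hy
    rw [Set.mem_compl_iff, not_not] at ha
    obtain rfl : a = d := D4_t_injective (hTd ha)
    exact hTU ha y hy
  · intro v
    by_cases h2 : v = 2
    · subst h2
      rw [centralSub_two, centralSub_two]
      exact hU
    · by_cases hv : v ∈ T
      · rw [centralSub_of_mem _ _ _ h2 hv, centralSub_of_notMem _ _ _ h2 (by simpa using hv)]
        exact isCompl_top_bot
      · rw [centralSub_of_notMem _ _ _ h2 hv, centralSub_of_mem _ _ _ h2 (by simpa using hv)]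
        exact isCompl_bot_top
  · rw [centralSub_two, Ne, Submodule.span_singleton_eq_bot]
    exact hx
  · have hcT : D4.t c ∈ Tᶜ := fun h => hdc (D4_t_injective (hTd h)).symm
    rw [centralSub_of_mem _ _ _ (D4_t_ne_two c) hcT]
    intro h
    have h1 := hdim1 _ (D4_t_ne_two c)
    rw [← finrank_top, h, finrank_bot] at h1
    exact zero_ne_one h1

theorem not_rlexLE_of_lt {a b c d : ℝ} (hab : a < b) (hbc : b < c) (hbd : b < d) :
    ¬ RLexLE {a, b, d} {a, c, d} := by
  intro h
  have hb : b ∈ ({a, b, d} : Finset ℝ) \ {a, c, d} := by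
    simp [hab.ne', hbc.ne, hbd.ne]
  have h1 := h.trans (Finset.min_le hb)
  have h2 : (c : WithTop ℝ) ≤ (({a, c, d} : Finset ℝ) \ {a, b, d}).min := by
    refine Finset.le_min fun y hy => ?_
    have : y = c := by
      simp only [Finset.mem_sdiff, Finset.mem_insert, Finset.mem_singleton] at hy
      tauto
    rw [this]
  exact absurd (WithTop.coe_le_coe.1 (h2.trans h1)) (not_le.2 hbc)

end QR

open QR in
theorem stmt15 (K : Type) [Field K] (M : Rep K D4) (hM : Indecomposable M)
    (hdim2 : Module.finrank K (M.space 2) = 2)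
    (hdim1 : ∀ v : Fin 4, v ≠ 2 → Module.finrank K (M.space v) = 1)
    (i : Fin 4) (hi : i = 0 ∨ i = 1 ∨ i = 3)
    (p : ∀ v, Submodule K (M.space v)) (hp : IndecSub M p)
    (hlen : ∑ v : Fin 4, Module.finrank K ↥(p v) = 4)
    (hcontain : (fun v => if v = i then (⊤ : Submodule K (M.space v)) else ⊥) ≤ p)
    (hfil : IndecFiltration M (m := 2)
      ![fun v => if v = i then (⊤ : Submodule K (M.space v)) else ⊥, p, fun _ => ⊤]) :
    ∀ l : Rep K D4 → ℝ, LengthFunction l →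
      ¬ IsGRFiltration l M (m := 2)
        ![fun v => if v = i then (⊤ : Submodule K (M.space v)) else ⊥, p, fun _ => ⊤] := by
  rintro l hl ⟨-, hmax⟩
  obtain ⟨a, rfl⟩ : ∃ a : Fin 3, i = D4.t a := by
    rcases D4_vertex_cases i with rfl | h
    · revert hi; decide
    · exact h
  obtain ⟨c, hca⟩ : ∃ c : Fin 3, c ≠ a := exists_ne a
  let s : ∀ v : Fin 4, Submodule K (M.space v) := fun v => if v = D4.t a then ⊤ else ⊥
  let m : ∀ v : Fin 4, Submodule K (M.space v) := fun _ => ⊤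
  have hs : IndecSub M s := hfil.1 0
  have hm : IndecSub M m := hfil.1 2
  -- a nonzero vector of the kernel of the arrow `c`
  let f : M.space 2 →ₗ[K] M.space (D4.t c) := M.map c
  obtain ⟨x, hxf, hx⟩ : ∃ x, f x = 0 ∧ x ≠ 0 := by
    have hker : LinearMap.ker f ≠ ⊥ := LinearMap.ker_ne_bot_of_finrank_lt (by
      rw [hdim2, hdim1 _ (D4_t_ne_two c)]; norm_num)
    obtain ⟨x, hxf, hx⟩ := (Submodule.ne_bot_iff _).1 hker
    exact ⟨x, hxf, hx⟩
  have hmap (b : Fin 3) (hb : b ≠ c) : (M.map b x : M.space (D4.t b)) ≠ 0 := fun h0 =>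
    not_indecomposable_of_map_eq_zero M hdim1 hb hx h0 hxf hM
  let P := centralSub M (Submodule.span K {x}) {D4.t c}ᶜ
  have hP2 : P 2 = Submodule.span K {x} := centralSub_two _ _ _
  have hPc : P (D4.t c) = ⊥ := centralSub_of_notMem _ _ _ (D4_t_ne_two c) (by simp)
  have hPb (b : Fin 3) (hb : b ≠ c) : P (D4.t b) = ⊤ :=
    centralSub_of_mem _ _ _ (D4_t_ne_two b) (fun h => hb (D4_t_injective h))
  have hPsub : IsSubRep M P := by
    refine isSubRep_centralSub _ _ _ fun b hb y hy => ?_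
    rw [Set.mem_compl_iff, not_not] at hb
    obtain rfl : b = c := D4_t_injective hb
    obtain ⟨k, rfl⟩ := Submodule.mem_span_singleton.1 hy
    change f (k • x) = 0
    rw [map_smul, hxf, smul_zero]
  have hxP : x ∈ P 2 := hP2 ▸ Submodule.mem_span_singleton_self x
  have hP : IndecSub M P := by
    refine ⟨hPsub, indecomposable_of_generator (restrictRep M P) (⟨x, hxP⟩ : P 2)
      (fun h => hx (congrArg (fun y : P 2 => (y : M.space 2)) h)) ?_ ?_⟩
    · rintro ⟨y, hy⟩
      have hy' := hy
      rw [hP2] at hy'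
      obtain ⟨k, hk⟩ := Submodule.mem_span_singleton.1 hy'
      exact ⟨k, Subtype.ext hk.symm⟩
    · rintro b ⟨y, hy⟩
      have hcoe := restrictRep_map_coe hPsub b (⟨x, hxP⟩ : P 2)
      by_cases hb : b = c
      · subst hb
        refine ⟨0, Subtype.ext ?_⟩
        rw [hPc, Submodule.mem_bot] at hy
        rw [zero_smul]
        exact hy
      · obtain ⟨k, hk⟩ := (finrank_eq_one_iff_of_nonzero' _ (hmap b hb)).1
          (hdim1 _ (D4_t_ne_two b)) y
        refine ⟨k, Subtype.ext ?_⟩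
        refine hk.symm.trans ?_
        exact congrArg (k • ·) hcoe.symm
  have hr2 : Module.finrank K (P 2) = 1 := by rw [hP2, finrank_span_singleton hx]
  have hrc : Module.finrank K (P (D4.t c)) = 0 := by rw [hPc, finrank_bot]
  have hrb (b : Fin 3) (hb : b ≠ c) : Module.finrank K (P (D4.t b)) = 1 := by
    rw [hPb b hb, finrank_top, hdim1 _ (D4_t_ne_two b)]
  have hle1 (q : ∀ v : Fin 4, Submodule K (M.space v)) (b : Fin 3) :
      Module.finrank K (q (D4.t b)) ≤ 1 :=
    (Submodule.finrank_le _).trans_eq (hdim1 _ (D4_t_ne_two b))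
  have hle2 : Module.finrank K (p 2) ≤ 2 := (Submodule.finrank_le _).trans_eq hdim2
  have hsum : Module.finrank K (p 2) + ∑ b : Fin 3, Module.finrank K (p (D4.t b)) = 4 := by
    rw [Fin.sum_univ_four] at hlen
    rw [Fin.sum_univ_three]
    change _ + (Module.finrank K (p 0) + Module.finrank K (p 1) + Module.finrank K (p 3)) = 4
    omega
  have hpb (b : Fin 3) (hb : b ≠ c) : Module.finrank K (p (D4.t b)) = 1 := by
    by_contra h1
    have h0 : Module.finrank K (p (D4.t b)) = 0 := by
      have := hle1 p b
      omega
    have hrest : ∑ b : Fin 3, Module.finrank K (p (D4.t b)) ≤ 2 := by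
      rw [← Finset.add_sum_erase _ _ (Finset.mem_univ b), h0, zero_add]
      refine (Finset.sum_le_card_nsmul _ _ 1 fun b' _ => hle1 p b').trans ?_
      simp
    have htop : p 2 = ⊤ := Submodule.eq_top_of_finrank_eq (by omega)
    have hmem : (M.map b x : M.space (D4.t b)) ∈ p (D4.t b) :=
      hp.1 b x (show x ∈ p 2 from htop ▸ Submodule.mem_top)
    rw [Submodule.finrank_eq_zero.1 h0, Submodule.mem_bot] at hmem
    exact hmap b hb hmem
  have hsum' : Module.finrank K (p 2) + Module.finrank K (p (D4.t c)) = 2 := by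
    rw [← Finset.add_sum_erase _ _ (Finset.mem_univ c),
      Finset.sum_congr rfl fun b hb => hpb b (Finset.ne_of_mem_erase hb)] at hsum
    rw [Finset.sum_const, Finset.card_erase_of_mem (Finset.mem_univ c), Finset.card_univ,
      Fintype.card_fin, smul_eq_mul] at hsum
    omega
  have hlt_sP : l (restrictRep M s) < l (restrictRep M P) := by
    refine hl.lt_of_finrank (fun v => ?_) ⟨2, ?_⟩
    · change Module.finrank K (s v) ≤ Module.finrank K (P v)
      by_cases hv : v = D4.t a
      · subst hv
        exact (hle1 s a).trans_eq (hrb a hca.symm).symm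
      · have : s v = ⊥ := if_neg hv
        rw [this, finrank_bot]
        exact Nat.zero_le _
    · change Module.finrank K (s 2) < Module.finrank K (P 2)
      have : s 2 = ⊥ := if_neg (D4_t_ne_two a).symm
      rw [this, finrank_bot, hr2]
      exact one_pos
  have hlt_Pp : l (restrictRep M P) < l (restrictRep M p) := by
    have hc1 := hle1 p c
    refine hl.lt_of_finrank (fun v => ?_) ?_
    · change Module.finrank K (P v) ≤ Module.finrank K (p v)
      rcases D4_vertex_cases v with rfl | ⟨b, rfl⟩
      · omega
      · by_cases hb : b = c
        · subst hb
          omega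
        · rw [hrb b hb, hpb b hb]
    · by_cases h2 : Module.finrank K (p 2) = 2
      · refine ⟨2, ?_⟩
        change Module.finrank K (P 2) < Module.finrank K (p 2)
        omega
      · refine ⟨D4.t c, ?_⟩
        change Module.finrank K (P (D4.t c)) < Module.finrank K (p (D4.t c))
        omega
  have hlt_Pm : l (restrictRep M P) < l (restrictRep M m) := by
    refine hl.lt_of_finrank (fun v => ?_) ⟨2, ?_⟩
    · change Module.finrank K (P v) ≤ Module.finrank K (⊤ : Submodule K (M.space v))
      rw [finrank_top]
      exact Submodule.finrank_le _
    · change Module.finrank K (P 2) < Module.finrank K (⊤ : Submodule K (M.space 2))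
      rw [finrank_top, hdim2, hr2]
      exact one_lt_two
  have hsP : s ≤ P := by
    intro v
    by_cases hv : v = D4.t a
    · subst hv
      rw [hPb a hca.symm]
      exact le_top
    · have : s v = ⊥ := if_neg hv
      rw [this]
      exact bot_le
  have htop (q : ∀ v : Fin 4, Submodule K (M.space v)) : q ≤ m := fun _ => le_top
  have hchain : IndecChain M {s, P, m} := by
    constructor
    · intro q hq
      simp only [Finset.mem_insert, Finset.mem_singleton] at hq
      rcases hq with rfl | rfl | rfl
      exacts [hs, hP, hm]
    · intro q hq r hr
      simp only [Finset.mem_insert, Finset.mem_singleton] at hq hr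
      rcases hq with rfl | rfl | rfl <;> rcases hr with rfl | rfl | rfl <;>
        simp only [le_refl, htop, hsP, true_or, or_true]
  have hrlex := hmax {s, P, m} hchain (by simp [m])
  have himage : Finset.image ![s, p, m] Finset.univ = {s, p, m} := by
    ext q
    simp [Fin.exists_fin_succ, eq_comm]
  change RLexLE _ (chainL l M (Finset.image ![s, p, m] Finset.univ)) at hrlex
  rw [himage] at hrlex
  simp only [chainL, Finset.image_insert, Finset.image_singleton] at hrlex
  exact not_rlexLE_of_lt hlt_sP hlt_Pp hlt_Pm hrlex
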